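/- Let M = (E,r) be a polymatroid, a ∈ E, and let k̲ and k̄ be the minimum and maximum of the coordinate x_a over x ∈ P(M); set N_{k̲} = {x ∈ P(M) : x_a = k̲} and N_{k̄} = {x ∈ P(M) : x_a = k̄}. Then for all nonnegative integers t, u: #((N_{k̄} + uΔ + t∇') ∩ ℤ^E) = Σ_{j=0}^{u} #((N_{k̄} + jΔ' + t∇') ∩ ℤ^E), and #((N_{k̲} + uΔ' + t∇) ∩ ℤ^E) = Σ_{i=0}^{t} #((N_{k̲} + uΔ' + i∇') ∩ ℤ^E). -/

import Mathlib

open scoped Pointwise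
open Finset

noncomputable section

/-- The standard simplex `Δ = conv{e_i : i ∈ E}` in `ℝ^E`. -/
def stdSimplexSet (α : Type*) [Fintype α] [DecidableEq α] : Set (α → ℝ) :=
  convexHull ℝ {x : α → ℝ | ∃ i : α, x = Pi.single i (1 : ℝ)}

/-- The number of lattice points (points of `ℤ^E`) in a subset of `ℝ^E`. -/
def latticeCount {α : Type*} (P : Set (α → ℝ)) : ℕ :=
  Set.ncard {q : α → ℤ | (fun i => (q i : ℝ)) ∈ P}

/-- `Qcount P t u` is the number of lattice points of `P + uΔ + t∇`. -/
def Qcount {α : Type*} [Fintype α] [DecidableEq α] (P : Set (α → ℝ)) (t u : ℕ) : ℕ :=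
  latticeCount (P + (u : ℝ) • stdSimplexSet α + (t : ℝ) • (-stdSimplexSet α))

/-- A polymatroid on a finite ground set, given by its rank function. -/
structure PolyMatroid (α : Type*) [Fintype α] [DecidableEq α] where
  rk : Finset α → ℕ
  rk_empty : rk ∅ = 0
  rk_mono : ∀ ⦃S T : Finset α⦄, S ⊆ T → rk S ≤ rk T
  rk_submod : ∀ S T : Finset α, rk (S ∪ T) + rk (S ∩ T) ≤ rk S + rk T

variable {α : Type*} [Fintype α] [DecidableEq α]

/-- A basis of a matroid (an independent spanning set). -/
def PolyMatroid.IsBasis (M : PolyMatroid α) (B : Finset α) : Prop :=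
  M.rk B = B.card ∧ M.rk B = M.rk Finset.univ

/-- The indicator vector of a finite set. -/
def indicatorVec {α : Type*} [DecidableEq α] (B : Finset α) : α → ℝ :=
  fun i => if i ∈ B then 1 else 0

/-- The base polytope of a matroid: the convex hull of indicator vectors of bases. -/
def matroidPolytope (M : PolyMatroid α) : Set (α → ℝ) :=
  convexHull ℝ {x : α → ℝ | ∃ B : Finset α, M.IsBasis B ∧ x = indicatorVec B}

/-- The base polytope of a polymatroid, by its inequality description. -/
def PolyMatroid.polytope (M : PolyMatroid α) : Set (α → ℝ) :=
  {x | (∑ i, x i) = (M.rk Finset.univ : ℝ) ∧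
    ∀ S : Finset α, (∑ i ∈ S, x i) ≤ (M.rk S : ℝ)}

/-- `c : ℕ × ℕ → ℤ` is a `Q'`-datum for the counting function `Q` if it is finitely
supported and interpolates `Q` in the binomial basis. -/
def IsQdatumFun (Q : ℕ → ℕ → ℕ) (c : ℕ × ℕ → ℤ) : Prop :=
  (Function.support c).Finite ∧
    ∀ t u : ℕ, (Q t u : ℤ) = ∑ᶠ p : ℕ × ℕ, c p * (t.choose p.1 : ℤ) * (u.choose p.2 : ℤ)

/-- A `Q'`-datum for the lattice-point counting function of the polytope `P`. -/
def IsQdatum (P : Set (α → ℝ)) (c : ℕ × ℕ → ℤ) : Prop :=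
  IsQdatumFun (Qcount P) c

/-- The polynomial `Q'` associated to a `Q'`-datum, as a function on `ℚ × ℚ`. -/
def Qprime (c : ℕ × ℕ → ℤ) (x y : ℚ) : ℚ :=
  ∑ᶠ p : ℕ × ℕ, (c p : ℚ) * (x - 1) ^ p.1 * (y - 1) ^ p.2

/-- The polynomial `Q'` associated to a `Q'`-datum, as a polynomial in two variables. -/
def QprimePoly (c : ℕ × ℕ → ℤ) : MvPolynomial (Fin 2) ℤ :=
  ∑ᶠ p : ℕ × ℕ,
    MvPolynomial.C (c p) * (MvPolynomial.X 0 - 1) ^ p.1 * (MvPolynomial.X 1 - 1) ^ p.2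

/-- The Tutte polynomial of a matroid, as a function on `ℚ × ℚ`. -/
def TuttePoly (M : PolyMatroid α) (x y : ℚ) : ℚ :=
  ∑ S : Finset α,
    (x - 1) ^ (M.rk Finset.univ - M.rk S) * (y - 1) ^ (S.card - M.rk S)


variable {α : Type*} [Fintype α] [DecidableEq α]

/-- The simplex `Δ' = conv{e_i : i ∈ E, i ≠ a}` in `ℝ^E`. -/
def stdSimplexAway (α : Type*) [Fintype α] [DecidableEq α] (a : α) : Set (α → ℝ) :=
  convexHull ℝ {x : α → ℝ | ∃ i : α, i ≠ a ∧ x = Pi.single i (1 : ℝ)}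

/-- The `a`-slice `N_k = {x ∈ P(M) : x_a = k}` of the base polytope. -/
def PolyMatroid.slice (M : PolyMatroid α) (a : α) (k : ℤ) : Set (α → ℝ) :=
  {x ∈ M.polytope | x a = (k : ℝ)}

theorem mem_convexHull_single_iff {α : Type*} [Fintype α] [DecidableEq α] (p : α → Prop)
    (x : α → ℝ) :
    x ∈ convexHull ℝ {x : α → ℝ | ∃ i : α, p i ∧ x = Pi.single i (1 : ℝ)} ↔
      (∀ i, 0 ≤ x i) ∧ ∑ i, x i = 1 ∧ ∀ i, ¬ p i → x i = 0 := by
  constructor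
  · intro hx
    have hconv : Convex ℝ {x : α → ℝ |
        (∀ i, 0 ≤ x i) ∧ ∑ i, x i = 1 ∧ ∀ i, ¬ p i → x i = 0} := by
      rintro x ⟨hx0, hx1, hxp⟩ y ⟨hy0, hy1, hyp⟩ b c hb hc hbc
      refine ⟨fun i => ?_, ?_, fun i hi => ?_⟩
      · exact add_nonneg (mul_nonneg hb (hx0 i)) (mul_nonneg hc (hy0 i))
      · simp [Finset.sum_add_distrib, ← Finset.mul_sum, hx1, hy1, hbc]
      · simp [hxp i hi, hyp i hi]
    refine convexHull_min ?_ hconv hx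
    rintro _ ⟨i, hi, rfl⟩
    refine ⟨fun j => ?_, by simp, fun j hj => ?_⟩
    · by_cases h : j = i
      · subst h; simp
      · simp [h]
    · have h : j ≠ i := fun h => hj (h ▸ hi)
      simp [h]
  · classical
    rintro ⟨h0, h1, hp⟩
    have hsum : ∑ i ∈ univ.filter p, x i = 1 := by
      rw [← h1]
      refine Finset.sum_subset (Finset.filter_subset _ _) fun i _ hi => hp i ?_
      simpa using hi
    have hx : ∑ i ∈ univ.filter p, x i • (Pi.single i (1 : ℝ) : α → ℝ) = x := by
      ext j
      by_cases hj : p j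
      · simp [Finset.sum_apply, Pi.single_apply, hj]
      · simp [Finset.sum_apply, Pi.single_apply, hj, hp j hj]
    rw [← hx]
    refine (convex_convexHull ℝ _).sum_mem (fun i _ => h0 i) hsum fun i hi => ?_
    exact subset_convexHull ℝ _ ⟨i, by simpa using hi, rfl⟩

theorem mem_smul_convexHull_single_iff {α : Type*} [Fintype α] [DecidableEq α] (p : α → Prop)
    (hp : ∃ i, p i) {c : ℝ} (hc : 0 ≤ c) (x : α → ℝ) :
    x ∈ c • convexHull ℝ {x : α → ℝ | ∃ i : α, p i ∧ x = Pi.single i (1 : ℝ)} ↔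
      (∀ i, 0 ≤ x i) ∧ ∑ i, x i = c ∧ ∀ i, ¬ p i → x i = 0 := by
  rcases hc.eq_or_lt with rfl | hc
  · obtain ⟨i, hi⟩ := hp
    have hne : (convexHull ℝ {x : α → ℝ | ∃ i : α, p i ∧ x = Pi.single i (1 : ℝ)}).Nonempty :=
      ⟨_, subset_convexHull ℝ _ ⟨i, hi, rfl⟩⟩
    rw [Set.zero_smul_set hne, Set.mem_zero]
    constructor
    · rintro rfl
      simp
    · rintro ⟨h0, h1, -⟩
      ext j
      exact (Finset.sum_eq_zero_iff_of_nonneg fun i _ => h0 i).1 h1 j (mem_univ j)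
  · rw [Set.mem_smul_set_iff_inv_smul_mem₀ hc.ne', mem_convexHull_single_iff]
    simp only [Pi.smul_apply, smul_eq_mul, ← Finset.mul_sum, mul_eq_zero, inv_eq_zero, hc.ne',
      false_or, inv_pos.2 hc, mul_nonneg_iff_of_pos_left, inv_mul_eq_one₀ hc.ne', eq_comm (a := c)]

theorem mem_smul_stdSimplexSet_iff {α : Type*} [Fintype α] [DecidableEq α] [Nonempty α]
    {c : ℝ} (hc : 0 ≤ c) (x : α → ℝ) :
    x ∈ c • stdSimplexSet α ↔ (∀ i, 0 ≤ x i) ∧ ∑ i, x i = c := by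
  simpa [stdSimplexSet] using
    mem_smul_convexHull_single_iff (fun _ : α => True) ⟨Classical.arbitrary α, trivial⟩ hc x

theorem mem_smul_stdSimplexAway_iff {α : Type*} [Fintype α] [DecidableEq α] [Nontrivial α]
    (a : α) {c : ℝ} (hc : 0 ≤ c) (x : α → ℝ) :
    x ∈ c • stdSimplexAway α a ↔ (∀ i, 0 ≤ x i) ∧ ∑ i, x i = c ∧ x a = 0 := by
  simpa [stdSimplexAway] using mem_smul_convexHull_single_iff (· ≠ a) (exists_ne a) hc x

theorem isBounded_stdSimplexSet (α : Type*) [Fintype α] [DecidableEq α] :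
    Bornology.IsBounded (stdSimplexSet α) := by
  refine isBounded_convexHull.2 (Set.Finite.isBounded ?_)
  refine (Set.finite_range fun i : α => (Pi.single i (1 : ℝ) : α → ℝ)).subset ?_
  rintro _ ⟨i, rfl⟩
  exact ⟨i, rfl⟩

theorem stdSimplexAway_subset (α : Type*) [Fintype α] [DecidableEq α] (a : α) :
    stdSimplexAway α a ⊆ stdSimplexSet α :=
  convexHull_mono fun _ ⟨i, _, hi⟩ => ⟨i, hi⟩

theorem PolyMatroid.isBounded_polytope {α : Type*} [Fintype α] [DecidableEq α]
    (M : PolyMatroid α) : Bornology.IsBounded M.polytope := by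
  refine (Metric.isBounded_Icc (0 : α → ℝ) fun i => (M.rk {i} : ℝ)).subset ?_
  rintro x ⟨hx, hS⟩
  refine ⟨fun i => ?_, fun i => by simpa using hS {i}⟩
  have h1 := hS (univ.erase i)
  have h2 : (M.rk (univ.erase i) : ℝ) ≤ M.rk univ := by
    exact_mod_cast M.rk_mono (Finset.erase_subset i univ)
  have h3 := Finset.add_sum_erase univ x (mem_univ i)
  simp only [Pi.zero_apply]
  linarith

theorem finite_lattice_points {α : Type*} [Fintype α] {P : Set (α → ℝ)}
    (hP : Bornology.IsBounded P) : {q : α → ℤ | (fun i => (q i : ℝ)) ∈ P}.Finite := by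
  classical
  obtain ⟨R, hR⟩ := hP.exists_norm_le
  refine (Set.finite_Icc (fun _ : α => -⌈R⌉) fun _ => ⌈R⌉).subset fun q hq => ?_
  have h : ∀ i, |q i| ≤ ⌈R⌉ := fun i => by
    have h1 : |(q i : ℝ)| ≤ R := (norm_le_pi_norm (fun i => (q i : ℝ)) i).trans (hR _ hq)
    have h2 : ((|q i| : ℤ) : ℝ) ≤ ⌈R⌉ := by
      push_cast
      exact h1.trans (Int.le_ceil R)
    exact_mod_cast h2
  exact ⟨fun i => (abs_le.1 (h i)).1, fun i => (abs_le.1 (h i)).2⟩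

theorem latticeCount_neg {α : Type*} (P : Set (α → ℝ)) : latticeCount (-P) = latticeCount P := by
  unfold latticeCount
  rw [← Set.ncard_image_of_injective _ (neg_injective (G := α → ℤ)), Set.image_neg_eq_neg]
  congr 1
  ext q
  have : (-fun i => (((-q) i : ℤ) : ℝ)) = fun i => (q i : ℝ) := by
    ext i
    simp
  simp only [Set.mem_neg, Set.mem_ofPred_eq, this]

/-- Adding the dilated simplex to a set lying in the hyperplane `x a = k`: the slice of the sum at
height `k + m` is a translate of the sum with the `m`-fold smaller dilate of the facet simplex. -/
theorem add_single_mem_add_smul_stdSimplexSet_iff {α : Type*} [Fintype α] [DecidableEq α]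
    [Nontrivial α] {A : Set (α → ℝ)} {a : α} {k : ℝ} (hA : ∀ x ∈ A, x a = k) {c m : ℝ}
    (hc : 0 ≤ c) (hm : 0 ≤ m) {x : α → ℝ} (hx : x a = k) :
    x + Pi.single a m ∈ A + (c + m) • stdSimplexSet α ↔ x ∈ A + c • stdSimplexAway α a := by
  simp only [Set.mem_add, mem_smul_stdSimplexSet_iff (add_nonneg hc hm),
    mem_smul_stdSimplexAway_iff a hc]
  constructor
  · rintro ⟨y, hy, z, ⟨hz0, hz1⟩, h⟩
    have hza : z a = m := by
      have := congrFun h a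
      simp only [Pi.add_apply, Pi.single_eq_same, hA y hy, hx] at this
      linarith
    refine ⟨y, hy, z - Pi.single a m, ⟨fun i => ?_, ?_, by simp [hza]⟩, ?_⟩
    · by_cases hi : i = a
      · subst hi; simp [hza]
      · simpa [hi] using hz0 i
    · simp [Finset.sum_sub_distrib, hz1]
    · rw [← add_sub_assoc, h, add_sub_cancel_right]
  · rintro ⟨y, hy, z, ⟨hz0, hz1, hza⟩, rfl⟩
    refine ⟨y, hy, z + Pi.single a m, ⟨fun i => ?_, ?_⟩, (add_assoc _ _ _).symm⟩
    · by_cases hi : i = a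
      · subst hi; simp [hza, hm]
      · simpa [hi] using hz0 i
    · simp [Finset.sum_add_distrib, hz1]

theorem latticeCount_add_smul_stdSimplexSet {α : Type*} [Fintype α] [DecidableEq α]
    [Nontrivial α] {A : Set (α → ℝ)} (hb : Bornology.IsBounded A) {a : α} {k : ℤ}
    (hA : ∀ x ∈ A, x a = k) (u : ℕ) :
    latticeCount (A + (u : ℝ) • stdSimplexSet α) =
      ∑ j ∈ Finset.range (u + 1), latticeCount (A + (j : ℝ) • stdSimplexAway α a) := by
  have hfin := finite_lattice_points (hb.add ((isBounded_stdSimplexSet α).smul₀ (u : ℝ)))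
  have hheight : ∀ q : α → ℤ, (fun i => (q i : ℝ)) ∈ A + (u : ℝ) • stdSimplexSet α →
      k ≤ q a ∧ q a ≤ k + u := by
    rintro q ⟨y, hy, z, hz, h⟩
    obtain ⟨hz0, hz1⟩ := (mem_smul_stdSimplexSet_iff u.cast_nonneg z).1 hz
    have h1 : (k : ℝ) + z a = q a := by
      rw [← hA y hy]
      exact congrFun h a
    have h2 : z a ≤ u := hz1 ▸ Finset.single_le_sum (fun i _ => hz0 i) (mem_univ a)
    have h3 := hz0 a
    constructor
    · have : (k : ℝ) ≤ q a := by linarith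
      exact_mod_cast this
    · have : (q a : ℝ) ≤ k + u := by linarith
      exact_mod_cast this
  rw [latticeCount, Set.ncard_eq_toFinset_card _ hfin,
    Finset.card_eq_sum_card_fiberwise (f := fun q => (k + u - q a).toNat)
      (t := Finset.range (u + 1))]
  · refine Finset.sum_congr rfl fun j hj => ?_
    have hju : j ≤ u := Nat.lt_succ_iff.1 (Finset.mem_range.1 hj)
    rw [latticeCount, ← Set.ncard_image_of_injective _
      (add_left_injective (Pi.single a ((u : ℤ) - j) : α → ℤ)), ← Set.ncard_coe_finset]
    congr 1
    ext q
    have hcast : (fun i => (q i : ℝ)) =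
        (fun i => (((q - (Pi.single a ((u : ℤ) - j) : α → ℤ)) i : ℤ) : ℝ)) +
          Pi.single a ((u : ℝ) - j) := by
      ext i
      by_cases hi : i = a
      · subst hi; simp
      · simp [hi]
    have hju' : (0 : ℝ) ≤ (u : ℝ) - j := sub_nonneg.2 (by exact_mod_cast hju)
    have key (hq : q a = k + (u - j)) :=
      add_single_mem_add_smul_stdSimplexSet_iff hA (j.cast_nonneg (α := ℝ)) hju'
        (x := fun i => (((q - (Pi.single a ((u : ℤ) - j) : α → ℤ)) i : ℤ) : ℝ)) (by simp [hq])
    rw [← hcast, add_sub_cancel] at key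
    simp only [Finset.coe_filter, Set.Finite.mem_toFinset, Set.mem_ofPred_eq, Set.mem_image]
    constructor
    · rintro ⟨hq, hj'⟩
      have := hheight q hq
      exact ⟨_, (key (by omega)).1 hq, sub_add_cancel _ _⟩
    · rintro ⟨p, hp, rfl⟩
      have hpa : p a = k := by
        obtain ⟨y, hy, z, hz, h⟩ := hp
        have h1 := congrFun h a
        have h2 := ((mem_smul_stdSimplexAway_iff a j.cast_nonneg z).1 hz).2.2
        simp only [Pi.add_apply, hA y hy, h2, add_zero] at h1
        exact_mod_cast h1.symm
      rw [add_sub_cancel_right] at key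
      exact ⟨(key (by simp [hpa])).2 hp, by simp [hpa]⟩
  · intro q hq
    have := hheight q (by simpa using hq)
    simp only [Finset.coe_range, Set.mem_Iio]
    omega

/-- For the extreme slices `N_k̄` (contraction) and `N_k̲` (deletion):
`#((N_k̄ + uΔ + t∇') ∩ ℤ^E) = Σ_{j=0}^{u} #((N_k̄ + jΔ' + t∇') ∩ ℤ^E)` and
`#((N_k̲ + uΔ' + t∇) ∩ ℤ^E) = Σ_{i=0}^{t} #((N_k̲ + uΔ' + i∇') ∩ ℤ^E)`. -/
theorem stmt_16 {α : Type*} [Fintype α] [DecidableEq α] (hcard : 2 ≤ Fintype.card α)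
    (M : PolyMatroid α) (a : α) (kl kh : ℤ)
    (hkl : IsLeast {r : ℝ | ∃ x ∈ M.polytope, x a = r} (kl : ℝ))
    (hkh : IsGreatest {r : ℝ | ∃ x ∈ M.polytope, x a = r} (kh : ℝ))
    (t u : ℕ) :
    latticeCount (M.slice a kh + (u : ℝ) • stdSimplexSet α +
        (t : ℝ) • (-stdSimplexAway α a)) =
      ∑ j ∈ Finset.range (u + 1),
        latticeCount (M.slice a kh + (j : ℝ) • stdSimplexAway α a +
          (t : ℝ) • (-stdSimplexAway α a)) ∧
    latticeCount (M.slice a kl + (u : ℝ) • stdSimplexAway α a +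
        (t : ℝ) • (-stdSimplexSet α)) =
      ∑ i ∈ Finset.range (t + 1),
        latticeCount (M.slice a kl + (u : ℝ) • stdSimplexAway α a +
          (i : ℝ) • (-stdSimplexAway α a)) := by
  have : Nontrivial α := Fintype.one_lt_card_iff_nontrivial.1 hcard
  have hN (k : ℤ) : Bornology.IsBounded (M.slice a k) :=
    M.isBounded_polytope.subset fun _ hx => hx.1
  have hΔ := (isBounded_stdSimplexSet α).subset (stdSimplexAway_subset α a)
  have hzero (c : ℕ) {z : α → ℝ} (hz : z ∈ (c : ℝ) • stdSimplexAway α a) : z a = 0 :=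
    ((mem_smul_stdSimplexAway_iff a c.cast_nonneg z).1 hz).2.2
  constructor
  · have hA : ∀ x ∈ M.slice a kh + (t : ℝ) • (-stdSimplexAway α a), x a = kh := by
      rintro _ ⟨y, hy, z, hz, rfl⟩
      rw [Set.smul_set_neg, Set.mem_neg] at hz
      have := hzero t hz
      have := hy.2
      simp_all
    simpa only [add_right_comm] using
      latticeCount_add_smul_stdSimplexSet ((hN kh).add (hΔ.neg.smul₀ (t : ℝ))) hA u
  · have hA : ∀ x ∈ -(M.slice a kl + (u : ℝ) • stdSimplexAway α a), x a = (-kl : ℤ) := by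
      rintro x ⟨y, hy, z, hz, h⟩
      have h1 := congrFun h a
      have h2 := hzero u hz
      have h3 := hy.2
      simp only [Pi.add_apply, Pi.neg_apply, h2, h3] at h1
      push_cast
      linarith
    have hneg (c : ℕ) (D : Set (α → ℝ)) :
        latticeCount (-(M.slice a kl + (u : ℝ) • stdSimplexAway α a) + (c : ℝ) • D) =
          latticeCount (M.slice a kl + (u : ℝ) • stdSimplexAway α a + (c : ℝ) • (-D)) := by
      rw [← latticeCount_neg, neg_add, neg_neg, Set.smul_set_neg]
    simpa only [hneg] using
      latticeCount_add_smul_stdSimplexSet ((hN kl).add (hΔ.smul₀ (u : ℝ))).neg hA t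

end
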